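/- For the sequence I_n = ⟨S_0,…,S_n⟩ on C_N with S_i = ⟨i+k, i+k−1, …, i+1, i+2, …, i+k⟩, LRU(I_n) = k + n and FIFO(I_n) = k + kn, hence lim (FIFO − LRU)/|I_n| = (k−1)/(2k−1) = 1/2 − 1/(4k−2). -/

import Mathlib

/-- One step of LRU with cache size `k`: cache is a list of pages, most
recently used first; returns the new cache and whether the request faulted. -/
def lruStep (k : ℕ) (c : List ℕ) (p : ℕ) : List ℕ × Bool :=
  if p ∈ c then (p :: c.erase p, false) else ((p :: c).take k, true)

/-- One step of FIFO with cache size `k`: cache is a list of pages, most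
recently entered first. -/
def fifoStep (k : ℕ) (c : List ℕ) (p : ℕ) : List ℕ × Bool :=
  if p ∈ c then (c, false) else ((p :: c).take k, true)

/-- One step of FWF (flush-when-full) with cache size `k`. -/
def fwfStep (k : ℕ) (c : List ℕ) (p : ℕ) : List ℕ × Bool :=
  if p ∈ c then (c, false)
  else if c.length = k then ([p], true) else (p :: c, true)

/-- Number of faults incurred by an algorithm given by `step`, starting from
an empty cache, on the request sequence `I`. -/
def runCost (step : List ℕ → ℕ → List ℕ × Bool) (I : List ℕ) : ℕ :=
  (I.foldl (fun s p => ((step s.1 p).1, s.2 + if (step s.1 p).2 then 1 else 0))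
    (([] : List ℕ), 0)).2

/-- Number of faults of LRU with cache size `k` on sequence `I`. -/
def lruCost (k : ℕ) (I : List ℕ) : ℕ := runCost (lruStep k) I

/-- Number of faults of FIFO with cache size `k` on sequence `I`. -/
def fifoCost (k : ℕ) (I : List ℕ) : ℕ := runCost (fifoStep k) I

/-- Number of faults of FWF with cache size `k` on sequence `I`. -/
def fwfCost (k : ℕ) (I : List ℕ) : ℕ := runCost (fwfStep k) I

/-- `n`-fold concatenation of the list `l`. -/
def repeatList (l : List ℕ) (n : ℕ) : List ℕ := (List.replicate n l).flatten

/-- `S_i = ⟨i+k, i+k−1, …, i+1, i+2, …, i+k⟩` on the cycle `C_N`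
(pages `1,…,N`, indices taken mod `N`). -/
def cycleS (k N i : ℕ) : List ℕ :=
  ((List.range' (i + 1) k).reverse ++ List.range' (i + 2) (k - 1)).map
    (fun p => (p - 1) % N + 1)

/-- `I_n = ⟨S_0, S_1, …, S_n⟩`. -/
def cycleI (k N n : ℕ) : List ℕ := ((List.range (n + 1)).map (cycleS k N)).flatten

/-- The page with index `p` on the cycle `C_N`. -/
def cyclePage (N p : ℕ) : ℕ := (p - 1) % N + 1

/-- The `k` consecutive pages starting at `a` on the cycle `C_N`. -/
def cycleWindow (k N a : ℕ) : List ℕ := (List.range' a k).map (cyclePage N)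

/-- Serve the requests `I` from the state `s` (cache and number of faults so far). -/
def serve (step : List ℕ → ℕ → List ℕ × Bool) (s : List ℕ × ℕ) (I : List ℕ) : List ℕ × ℕ :=
  I.foldl (fun s p => ((step s.1 p).1, s.2 + if (step s.1 p).2 then 1 else 0)) s

theorem serve_append (step : List ℕ → ℕ → List ℕ × Bool) (s : List ℕ × ℕ) (I J : List ℕ) :
    serve step s (I ++ J) = serve step (serve step s I) J :=
  List.foldl_append

theorem serve_cons (step : List ℕ → ℕ → List ℕ × Bool) (c : List ℕ) (m p : ℕ) (I : List ℕ) :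
    serve step (c, m) (p :: I) =
      serve step ((step c p).1, m + if (step c p).2 then 1 else 0) I :=
  rfl

theorem lruStep_of_notMem {k p : ℕ} {c : List ℕ} (h : p ∉ c) :
    lruStep k c p = ((p :: c).take k, true) := if_neg h

theorem lruStep_of_mem {k p : ℕ} {c : List ℕ} (h : p ∈ c) :
    lruStep k c p = (p :: c.erase p, false) := if_pos h

theorem fifoStep_of_notMem {k p : ℕ} {c : List ℕ} (h : p ∉ c) :
    fifoStep k c p = ((p :: c).take k, true) := if_neg h

theorem fifoStep_of_mem {k p : ℕ} {c : List ℕ} (h : p ∈ c) :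
    fifoStep k c p = (c, false) := if_pos h

/-- Distinct new pages that fit in the cache all fault, and nothing is evicted. -/
theorem serve_of_nodup_append {k : ℕ} {step : List ℕ → ℕ → List ℕ × Bool}
    (hstep : ∀ c p, p ∉ c → step c p = ((p :: c).take k, true)) (L c : List ℕ) (m : ℕ)
    (hn : (L ++ c).Nodup) (hl : L.length + c.length ≤ k) :
    serve step (c, m) L = (L.reverse ++ c, m + L.length) := by
  induction L generalizing c m with
  | nil => rfl
  | cons p L ih =>
    have hp : p ∉ c := by
      simp only [List.cons_append, List.nodup_cons, List.mem_append] at hn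
      tauto
    simp only [List.length_cons] at hl
    rw [serve_cons, hstep c p hp, List.take_of_length_le (by simp; omega),
      ih _ _ (List.perm_middle.nodup_iff.2 hn) (by simp; omega)]
    simp [add_comm, add_left_comm]

theorem serve_fifo_of_subset {k : ℕ} {c L : List ℕ} (m : ℕ) (h : L ⊆ c) :
    serve (fifoStep k) (c, m) L = (c, m) := by
  induction L with
  | nil => rfl
  | cons p L ih =>
    rw [List.cons_subset] at h
    rw [serve_cons, fifoStep_of_mem h.1]
    exact ih h.2

theorem cons_diff_of_notMem {p : ℕ} {L : List ℕ} (c : List ℕ) (h : p ∉ L) :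
    (p :: c).diff L = p :: c.diff L := by
  induction L generalizing c with
  | nil => simp
  | cons q L ih =>
    rw [List.mem_cons, not_or] at h
    rw [List.diff_cons, List.diff_cons, List.erase_cons_tail (by simpa using h.1), ih _ h.2]

/-- Distinct cached pages move to the front of the LRU cache without a fault. -/
theorem serve_lru_of_subset {k : ℕ} {c L : List ℕ} (m : ℕ) (hL : L.Nodup) (h : L ⊆ c) :
    serve (lruStep k) (c, m) L = (L.reverse ++ c.diff L, m) := by
  induction L generalizing c with
  | nil => simp [serve]
  | cons p L ih =>
    rw [List.cons_subset] at h
    rw [List.nodup_cons] at hL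
    have hsub : L ⊆ p :: c.erase p := fun x hx =>
      List.mem_cons_of_mem _ ((List.mem_erase_of_ne (ne_of_mem_of_not_mem hx hL.1)).2 (h.2 hx))
    rw [serve_cons, lruStep_of_mem h.1]
    refine (ih hL.2 hsub).trans ?_
    rw [cons_diff_of_notMem _ hL.1, List.diff_cons]
    simp

theorem diff_self_eq_nil (L : List ℕ) : L.diff L = [] := by
  induction L with
  | nil => rfl
  | cons p L ih => simpa using ih

theorem serve_lru_tail {k : ℕ} {W : List ℕ} (m : ℕ) (hW : W.Nodup) :
    serve (lruStep k) (W, m) W.tail = (W.reverse, m) := by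
  cases W with
  | nil => rfl
  | cons a M =>
    rw [List.nodup_cons] at hW
    rw [List.tail_cons, serve_lru_of_subset m hW.2 (List.subset_cons_self _ _),
      cons_diff_of_notMem _ hW.1, diff_self_eq_nil, List.reverse_cons]

theorem serve_lru_reverse {k : ℕ} {W : List ℕ} (m : ℕ) (hW : W.Nodup) :
    serve (lruStep k) (W.reverse, m) W.reverse = (W, m) := by
  rw [serve_lru_of_subset m (List.nodup_reverse.2 hW) (List.Subset.refl _), diff_self_eq_nil]
  simp

theorem cyclePage_injOn {N a p q : ℕ} (ha : 1 ≤ a) (hp : a ≤ p) (hp' : p < a + N)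
    (hq : a ≤ q) (hq' : q < a + N) (h : cyclePage N p = cyclePage N q) : p = q := by
  have h1 : (p - 1) ≡ (q - 1) [MOD N] := Nat.succ.inj h
  wlog hpq : p ≤ q generalizing p q
  · exact (this hq hq' hp hp' h.symm h1.symm (by omega)).symm
  have h2 : N ∣ (q - 1) - (p - 1) := (Nat.modEq_iff_dvd' (by omega)).1 h1
  have h3 := Nat.eq_zero_of_dvd_of_lt h2 (by omega)
  omega

theorem cycleWindow_nodup {k N a : ℕ} (ha : 1 ≤ a) (hk : k ≤ N) :
    (cycleWindow k N a).Nodup := by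
  refine List.Nodup.map_on (fun p hp q hq h => ?_) List.nodup_range'
  rw [List.mem_range'_1] at hp hq
  exact cyclePage_injOn ha hp.1 (by omega) hq.1 (by omega) h

theorem length_cycleWindow (k N a : ℕ) : (cycleWindow k N a).length = k := by
  simp [cycleWindow]

theorem cycleWindow_succ (k N a : ℕ) :
    cycleWindow (k + 1) N a = cyclePage N a :: cycleWindow k N (a + 1) := by
  simp [cycleWindow, List.range'_succ]

theorem cycleWindow_succ' (k N a : ℕ) :
    cycleWindow (k + 1) N a = cycleWindow k N a ++ [cyclePage N (a + k)] := by
  simp [cycleWindow, List.range'_concat]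

theorem cycleS_eq (k N i : ℕ) :
    cycleS k N i = (cycleWindow k N (i + 1)).reverse ++ (cycleWindow k N (i + 1)).tail := by
  change ((List.range' (i + 1) k).reverse ++ List.range' (i + 2) (k - 1)).map (cyclePage N) = _
  simp [cycleWindow, List.map_reverse, ← List.map_tail, List.tail_range']

theorem cycleI_zero (k N : ℕ) : cycleI k N 0 = cycleS k N 0 := by
  simp [cycleI]

theorem cycleI_succ (k N n : ℕ) : cycleI k N (n + 1) = cycleI k N n ++ cycleS k N (n + 1) := by
  rw [cycleI, List.range_succ, List.map_append, List.flatten_append]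
  simp [cycleI]

theorem length_cycleI (k N n : ℕ) : (cycleI k N n).length = (2 * k - 1) * (n + 1) := by
  have hS (i : ℕ) : (cycleS k N i).length = 2 * k - 1 := by
    simp [cycleS]
    omega
  induction n with
  | zero => rw [cycleI_zero, hS]; simp
  | succ n ih => rw [cycleI_succ, List.length_append, ih, hS]; ring

/-- The page following a window faults and pushes the oldest page of the window out. -/
theorem serve_lru_cycleS {k N a m : ℕ} (hk : 1 ≤ k) (hN : k + 1 ≤ N) :
    serve (lruStep k) ((cycleWindow k N (a + 1)).reverse, m) (cycleS k N (a + 1)) =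
      ((cycleWindow k N (a + 2)).reverse, m + 1) := by
  obtain ⟨j, rfl⟩ : ∃ j, k = j + 1 := ⟨k - 1, by omega⟩
  have hW : (cycleWindow (j + 1) N (a + 2)).Nodup := cycleWindow_nodup (by omega) (by omega)
  have hbig : (cycleWindow (j + 2) N (a + 1)).Nodup := cycleWindow_nodup (by omega) hN
  set p := cyclePage N (a + 2 + j)
  have hrev : (cycleWindow (j + 1) N (a + 2)).reverse = p :: (cycleWindow j N (a + 2)).reverse := by
    simp [cycleWindow_succ', p]
  have hp : p ∉ (cycleWindow (j + 1) N (a + 1)).reverse := by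
    rw [cycleWindow_succ', show a + 1 + (j + 1) = a + 2 + j by ring] at hbig
    have := (List.nodup_append.1 hbig).2.2
    intro h
    exact this p (List.mem_reverse.1 h) p (by simp [p]) rfl
  have hmiss : lruStep (j + 1) (cycleWindow (j + 1) N (a + 1)).reverse p =
      ((cycleWindow (j + 1) N (a + 2)).reverse, true) := by
    rw [lruStep_of_notMem hp, hrev, cycleWindow_succ, List.take_succ_cons, List.reverse_cons,
      List.take_left' (by simp [length_cycleWindow])]
  have hhit : lruStep (j + 1) (cycleWindow (j + 1) N (a + 2)).reverse p =
      ((cycleWindow (j + 1) N (a + 2)).reverse, false) := by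
    rw [hrev, lruStep_of_mem (by simp)]
    simp
  have hdown : serve (lruStep (j + 1)) ((cycleWindow (j + 1) N (a + 1)).reverse, m)
      (cycleWindow (j + 1) N (a + 2)).reverse = (cycleWindow (j + 1) N (a + 2), m + 1) := by
    rw [← serve_lru_reverse (k := j + 1) (m + 1) hW]
    conv_lhs => rw [hrev, serve_cons, hmiss]
    conv_rhs => arg 3; rw [hrev]
    rw [serve_cons, hhit]
    rfl
  rw [cycleS_eq, serve_append, hdown, serve_lru_tail _ hW]

/-- Requesting the pages after a full FIFO window in descending order always faults. -/
theorem serve_fifo_descending {k N a t j m : ℕ} (ha : 1 ≤ a) (hj : j + t = k) (hN : k + 1 ≤ N) :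
    serve (fifoStep k) (cycleWindow j N (a + 1 + t) ++ cycleWindow t N a, m)
      (cycleWindow t N (a + 1)).reverse = (cycleWindow k N (a + 1), m + t) := by
  induction t generalizing j m with
  | zero => simp_all [serve, cycleWindow]
  | succ t ih =>
    have hp : cyclePage N (a + 1 + t) ∉
        cycleWindow j N (a + 1 + (t + 1)) ++ cycleWindow (t + 1) N a := by
      simp only [cycleWindow, List.mem_append, List.mem_map, List.mem_range'_1, not_or,
        not_exists, not_and]
      constructor <;> intro q hq h <;>
        have := cyclePage_injOn ha (by omega) (by omega) (by omega) (by omega) h <;> omega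
    have hcache : (cyclePage N (a + 1 + t) ::
        (cycleWindow j N (a + 1 + (t + 1)) ++ cycleWindow (t + 1) N a)).take k =
        cycleWindow (j + 1) N (a + 1 + t) ++ cycleWindow t N a := by
      rw [cycleWindow_succ' t, cycleWindow_succ j, ← List.append_assoc, ← List.cons_append,
        ← List.cons_append, List.take_left' (by simp [length_cycleWindow]; omega)]
      rfl
    rw [cycleWindow_succ' t N (a + 1), List.reverse_append, List.reverse_singleton,
      List.singleton_append, serve_cons, fifoStep_of_notMem hp]
    simp only [hcache, if_true]
    rw [ih (by omega)]
    congr 1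
    ring

theorem serve_fifo_cycleS {k N a m : ℕ} (hN : k + 1 ≤ N) :
    serve (fifoStep k) (cycleWindow k N (a + 1), m) (cycleS k N (a + 1)) =
      (cycleWindow k N (a + 2), m + k) := by
  have h := serve_fifo_descending (k := k) (N := N) (a := a + 1) (t := k) (j := 0) (m := m)
    (by omega) (by omega) hN
  rw [cycleS_eq, serve_append]
  refine (congrArg (fun s => serve (fifoStep k) s _) h).trans ?_
  exact serve_fifo_of_subset _ (List.tail_subset _)

theorem serve_window_of_empty {k N a : ℕ} {step : List ℕ → ℕ → List ℕ × Bool}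
    (hstep : ∀ c p, p ∉ c → step c p = ((p :: c).take k, true)) (ha : 1 ≤ a) (hN : k ≤ N) :
    serve step ([], 0) (cycleWindow k N a).reverse = (cycleWindow k N a, k) := by
  rw [serve_of_nodup_append hstep _ _ _ (by simpa using cycleWindow_nodup ha hN)
    (by simp [length_cycleWindow])]
  simp [length_cycleWindow]

theorem serve_lru_cycleI {k N : ℕ} (hk : 1 ≤ k) (hN : k + 1 ≤ N) (n : ℕ) :
    serve (lruStep k) ([], 0) (cycleI k N n) = ((cycleWindow k N (n + 1)).reverse, k + n) := by
  induction n with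
  | zero =>
    rw [cycleI_zero, cycleS_eq, serve_append,
      serve_window_of_empty (fun _ _ => lruStep_of_notMem) (by omega) (by omega),
      serve_lru_tail _ (cycleWindow_nodup (by omega) (by omega))]
    rfl
  | succ n ih => rw [cycleI_succ, serve_append, ih, serve_lru_cycleS hk hN]; rfl

theorem serve_fifo_cycleI {k N : ℕ} (hN : k + 1 ≤ N) (n : ℕ) :
    serve (fifoStep k) ([], 0) (cycleI k N n) = (cycleWindow k N (n + 1), k + k * n) := by
  induction n with
  | zero =>
    rw [cycleI_zero, cycleS_eq, serve_append,
      serve_window_of_empty (fun _ _ => fifoStep_of_notMem) (by omega) (by omega),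
      serve_fifo_of_subset _ (List.tail_subset _)]
    rfl
  | succ n ih => rw [cycleI_succ, serve_append, ih, serve_fifo_cycleS hN, mul_add_one, add_assoc]

theorem lruCost_cycleI {k N : ℕ} (hk : 1 ≤ k) (hN : k + 1 ≤ N) (n : ℕ) :
    lruCost k (cycleI k N n) = k + n :=
  congrArg Prod.snd (serve_lru_cycleI hk hN n)

theorem fifoCost_cycleI {k N : ℕ} (hN : k + 1 ≤ N) (n : ℕ) :
    fifoCost k (cycleI k N n) = k + k * n :=
  congrArg Prod.snd (serve_fifo_cycleI hN n)

open Filter in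
/-- For the sequence `I_n = ⟨S_0,…,S_n⟩` on `C_N`, `LRU(I_n) = k + n` and
`FIFO(I_n) = k + kn`, hence
`(FIFO(I_n) − LRU(I_n))/|I_n| → (k−1)/(2k−1) = 1/2 − 1/(4k−2)`. -/
theorem stmt14 (k N : ℕ) (hk : 2 ≤ k) (hN : k + 1 ≤ N) :
    (∀ n, lruCost k (cycleI k N n) = k + n ∧ fifoCost k (cycleI k N n) = k + k * n) ∧
    Tendsto
      (fun n : ℕ =>
        ((fifoCost k (cycleI k N n) : ℝ) - (lruCost k (cycleI k N n) : ℝ)) /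
          ((cycleI k N n).length : ℝ))
      atTop (nhds (((k : ℝ) - 1) / (2 * k - 1))) ∧
    ((k : ℝ) - 1) / (2 * k - 1) = 1 / 2 - 1 / (4 * k - 2) := by
  have hk' : (2 : ℝ) ≤ k := by exact_mod_cast hk
  have h1 : (2 * k - 1 : ℝ) ≠ 0 := by linarith
  refine ⟨fun n => ⟨lruCost_cycleI (by omega) hN n, fifoCost_cycleI hN n⟩, ?_, ?_⟩
  · have hlim : Tendsto (fun n : ℕ => ((k : ℝ) - 1) / (2 * k - 1) * (n / (n + 1 : ℝ))) atTop
        (nhds (((k : ℝ) - 1) / (2 * k - 1) * 1)) :=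
      (tendsto_natCast_div_add_atTop (1 : ℝ)).const_mul _
    rw [mul_one] at hlim
    refine hlim.congr fun n => ?_
    have h2 : (n + 1 : ℝ) ≠ 0 := by positivity
    rw [lruCost_cycleI (by omega) hN, fifoCost_cycleI hN, length_cycleI]
    push_cast [Nat.cast_sub (show 1 ≤ 2 * k by omega)]
    field_simp
    ring
  · have h2 : (4 * k - 2 : ℝ) ≠ 0 := by linarith
    rw [div_sub_div _ _ two_ne_zero h2, div_eq_div_iff h1 (mul_ne_zero two_ne_zero h2)]
    ring
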